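/- Let n and k be integers with 0 ≤ k ≤ n−3. Then P_n^k is the unique first graph in the S-order among 𝒢_n^k; that is, every connected n-vertex graph G with exactly k cut edges that is not isomorphic to P_n^k satisfies P_n^k ≺_s G. -/

import Mathlib

open SimpleGraph

/-- The `k`-th spectral moment of a graph: the trace of the `k`-th power of its
adjacency matrix. -/
noncomputable def specMoment {V : Type*} [Fintype V] (G : SimpleGraph V) (k : ℕ) : ℝ :=
  letI := Classical.decEq V
  letI : DecidableRel G.Adj := Classical.decRel _
  Matrix.trace ((G.adjMatrix ℝ) ^ k)

/-- The strict lexicographic order by spectral moments (`S`-order) for graphs on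
`n` vertices. -/
def SLt {V W : Type*} [Fintype V] [Fintype W] (n : ℕ)
    (G : SimpleGraph V) (H : SimpleGraph W) : Prop :=
  ∃ k, 1 ≤ k ∧ k ≤ n - 1 ∧ (∀ i, i < k → specMoment G i = specMoment H i) ∧
    specMoment G k < specMoment H k

/-- The number of cut edges (bridges) of a graph. -/
noncomputable def numBridges {V : Type*} (G : SimpleGraph V) : ℕ :=
  {e : Sym2 V | G.IsBridge e}.ncard

/-- `PnK n k`: the `n`-vertex graph obtained from the cycle `C_{n-k}` on the
vertices `0, 1, …, n-k-1` by identifying one end-vertex of a path on `k + 1`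
vertices with the cycle vertex `0` (so the attached path is
`0, n-k, n-k+1, …, n-1`). In particular `PnK n 0 = C_n`. -/
def PnK (n k : ℕ) : SimpleGraph (Fin n) :=
  SimpleGraph.fromRel (fun i j =>
    ((j : ℕ) = (i : ℕ) + 1 ∧ (i : ℕ) + 1 ≤ n - 1 ∧ (i : ℕ) + 1 ≠ n - k) ∨
    ((i : ℕ) = 0 ∧ (j : ℕ) = n - k - 1) ∨
    ((i : ℕ) = 0 ∧ (j : ℕ) = n - k))


def nadj (n k x y : ℕ) : Prop := x ≠ y ∧
    (((y = x + 1 ∧ x + 1 ≠ n - k) ∨ (x = 0 ∧ y = n - k - 1) ∨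
      (x = 0 ∧ y = n - k)) ∨
    ((x = y + 1 ∧ y + 1 ≠ n - k) ∨ (y = 0 ∧ x = n - k - 1) ∨
      (y = 0 ∧ x = n - k)))

instance (n k x y : ℕ) : Decidable (nadj n k x y) := by unfold nadj; infer_instance

lemma quad_aux (n k x y z w : ℕ) (hk : k + 3 ≤ n) (h1 : nadj n k x y)  (h2 : nadj n k y z) 
   (h3 : nadj n k z w)  (h4 : nadj n k w x) (h5 : x ≠ z) (h6 : y ≠ w) : k + 4 = n ∧ x < 4 := by
  unfold nadj at *
  obtain ⟨g, rfl⟩ : ∃ g, n = k + g := ⟨n - k, by omega⟩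
  have e1 : k + g - k = g := by omega
  simp only [e1] at *
  constructor
  · omega
  · omega

lemma quad_aux2 (n k x y z w : ℕ) (hk : k + 4 = n) (h1 : nadj n k x y)  (h2 : nadj n k y z) 
   (h3 : nadj n k z w)  (h4 : nadj n k w x) (h5 : x ≠ z) (h6 : y ≠ w) : 
    (x, y, z, w) ∈ ({(0,1,2,3),(0,3,2,1),(1,2,3,0),(1,0,3,2),(2,3,0,1),(2,1,0,3),(3,0,1,2),(3,2,1,0)} :
    Finset (ℕ × ℕ × ℕ × ℕ)) := by
  have hx := (quad_aux n k x y z w (by omega) h1 h2 h3 h4 h5 h6).2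
  have hy := (quad_aux n k y z w x (by omega) h2 h3 h4 h1 h6 h5.symm).2
  have hz := (quad_aux n k z w x y (by omega) h3 h4 h1 h2 h5.symm h6.symm).2
  have hw := (quad_aux n k w x y z (by omega) h4 h1 h2 h3 h6.symm h5).2
  have e1 : n - k = 4 := by omega
  unfold nadj at h1 h2 h3 h4
  simp only [e1] at h1 h2 h3 h4
  have : ∀ x y z w : Fin 4, nadj 4 0 x y → nadj 4 0 y z → nadj 4 0 z w → nadj 4 0 w x →
     x.1 ≠ z.1 → y.1 ≠ w.1 → (x.1, y.1, z.1, w.1) ∈ ({(0,1,2,3),(0,3,2,1),(1,2,3,0),(1,0,3,2),(2,3,0,1),(2,1,0,3),(3,0,1,2),(3,2,1,0)} :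
    Finset (ℕ × ℕ × ℕ × ℕ)) := by decide
  exact this ⟨x, hx⟩ ⟨y, hy⟩ ⟨z, hz⟩ ⟨w, hw⟩ h1 h2 h3 h4 h5 h6

lemma tri_aux (n k x y z : ℕ) (hk : k + 3 ≤ n) (h1 : nadj n k x y)  (h2 : nadj n k y z) 
   (h3 : nadj n k z x) : k + 3 = n ∧ x < 3 := by
  unfold nadj at *
  omega

lemma tri_aux2 (n k x y z : ℕ) (hk : k + 3 = n) (h1 : nadj n k x y)  (h2 : nadj n k y z) 
   (h3 : nadj n k z x) : 
    (x, y, z) ∈ ({(0,1,2),(0,2,1),(1,0,2),(1,2,0),(2,0,1),(2,1,0)} : Finset (ℕ × ℕ × ℕ)) := by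
  have hx := (tri_aux n k x y z (by omega) h1 h2 h3).2
  have hy := (tri_aux n k y z x (by omega) h2 h3 h1).2
  have hz := (tri_aux n k z x y (by omega) h3 h1 h2).2
  have e1 : n - k = 3 := by omega
  unfold nadj at h1 h2 h3
  simp only [e1] at h1 h2 h3
  have : ∀ x y z : Fin 3, nadj 3 0 x y → nadj 3 0 y z → nadj 3 0 z x →
     (x.1, y.1, z.1) ∈ ({(0,1,2),(0,2,1),(1,0,2),(1,2,0),(2,0,1),(2,1,0)} : Finset (ℕ × ℕ × ℕ)) := by
    decide
  exact this ⟨x, hx⟩ ⟨y, hy⟩ ⟨z, hz⟩ h1 h2 h3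

section helpers
open Finset
open scoped Classical

lemma specMoment_eq {V : Type*} [Fintype V] (G : SimpleGraph V) (k : ℕ) :
    specMoment G k = Matrix.trace ((G.adjMatrix ℝ) ^ k) := by
  unfold specMoment
  congr!

/-- number of ordered triangles -/
noncomputable def triC {V : Type*} [Fintype V] (G : SimpleGraph V) : ℕ :=
  #(univ.filter fun t : V × V × V => G.Adj t.1 t.2.1 ∧ G.Adj t.2.1 t.2.2 ∧ G.Adj t.2.2 t.1)

/-- number of ordered 4-cycles -/
noncomputable def quadC {V : Type*} [Fintype V] (G : SimpleGraph V) : ℕ :=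
  #(univ.filter fun t : V × V × V × V => G.Adj t.1 t.2.1 ∧ G.Adj t.2.1 t.2.2.1 ∧
    G.Adj t.2.2.1 t.2.2.2 ∧ G.Adj t.2.2.2 t.1 ∧ t.1 ≠ t.2.2.1 ∧ t.2.1 ≠ t.2.2.2)

lemma specMoment_zero {V : Type*} [Fintype V] (G : SimpleGraph V) :
    specMoment G 0 = Fintype.card V := by
  rw [specMoment_eq]; simp

lemma specMoment_one {V : Type*} [Fintype V] (G : SimpleGraph V) :
    specMoment G 1 = 0 := by
  rw [specMoment_eq]; simp

lemma sum_adj {V : Type*} [Fintype V] (G : SimpleGraph V) (x : V) :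
    ∑ y, (if G.Adj x y then (1:ℝ) else 0) = G.degree x := by
  simp [← SimpleGraph.card_neighborFinset_eq_degree, SimpleGraph.neighborFinset_eq_filter]

lemma specMoment_two {V : Type*} [Fintype V] (G : SimpleGraph V) :
    specMoment G 2 = ∑ x, (G.degree x : ℝ) := by
  rw [specMoment_eq, pow_two, Matrix.trace]
  refine Finset.sum_congr rfl fun x _ => ?_
  simp only [Matrix.diag_apply]
  rw [SimpleGraph.adjMatrix_mul_self_apply_self]

lemma specMoment_three {V : Type*} [Fintype V] (G : SimpleGraph V) :
    specMoment G 3 = triC G := by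
  rw [specMoment_eq, pow_succ, pow_two, Matrix.trace, triC, Finset.card_filter]
  simp only [Matrix.diag_apply, Matrix.mul_apply, SimpleGraph.adjMatrix_apply, Finset.sum_mul,
    Fintype.sum_prod_type, Nat.cast_sum]
  refine Finset.sum_congr rfl fun x _ => ?_
  rw [Finset.sum_comm]
  refine Finset.sum_congr rfl fun y _ => Finset.sum_congr rfl fun z _ => ?_
  by_cases h1 : G.Adj x y <;> by_cases h2 : G.Adj y z <;> by_cases h3 : G.Adj z x <;>
    simp [h1, h2, h3]

lemma specMoment_four {V : Type*} [Fintype V] (G : SimpleGraph V) :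
    specMoment G 4 = 2 * ∑ x, (G.degree x : ℝ)^2 - ∑ x, (G.degree x : ℝ) + quadC G := by
  set a : V → V → ℝ := fun x y => if G.Adj x y then (1:ℝ) else 0 with ha
  have hsum : ∀ x, ∑ y, a x y = G.degree x := sum_adj G
  have hsymm : ∀ x y, a x y = a y x := fun x y => by simp [ha, G.adj_comm]
  have hsq : ∀ x y, a x y * a x y = a x y := fun x y => by simp [ha]
  have h1 : specMoment G 4 = ∑ x, ∑ z, ∑ y, ∑ w, a x z * a z y * a y w * a w x := by
    rw [specMoment_eq, pow_succ, pow_succ, pow_two, Matrix.trace]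
    simp only [Matrix.diag_apply, Matrix.mul_apply, SimpleGraph.adjMatrix_apply, Finset.sum_mul]
    refine Finset.sum_congr rfl fun x _ => ?_
    rw [Finset.sum_comm]
    conv_lhs => rw [Finset.sum_comm]
    conv_rhs => rw [Finset.sum_comm]
    conv_rhs => enter [2, y]; rw [Finset.sum_comm]
    rw [Finset.sum_comm]
  have h2 : (quadC G : ℝ) = ∑ x, ∑ z, ∑ y, ∑ w,
      if x ≠ y ∧ z ≠ w then a x z * a z y * a y w * a w x else 0 := by
    rw [quadC, Finset.card_filter]
    simp only [Fintype.sum_prod_type, Nat.cast_sum]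
    refine Finset.sum_congr rfl fun x _ => Finset.sum_congr rfl fun z _ =>
      Finset.sum_congr rfl fun y _ => Finset.sum_congr rfl fun w _ => ?_
    simp only [ha]
    by_cases h1 : G.Adj x z <;> by_cases h2 : G.Adj z y <;> by_cases h3 : G.Adj y w <;>
      by_cases h4 : G.Adj w x <;> simp [h1, h2, h3, h4]
  have h3 : ∑ x, ∑ z, ∑ y, ∑ w, (if x = y then a x z * a z y * a y w * a w x else 0)
      = ∑ x, (G.degree x : ℝ)^2 := by
    refine Finset.sum_congr rfl fun x _ => ?_
    rw [pow_two, ← hsum, Finset.sum_mul_sum]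
    refine Finset.sum_congr rfl fun z _ => ?_
    rw [Finset.sum_comm]
    refine Finset.sum_congr rfl fun w _ => ?_
    simp only [Finset.sum_ite_eq, Finset.mem_univ, if_true]
    rw [hsymm z x, hsq, hsymm w x, mul_assoc, hsq]
  have h4 : ∑ x, ∑ z, ∑ y, ∑ w, (if z = w then a x z * a z y * a y w * a w x else 0)
      = ∑ x, (G.degree x : ℝ)^2 := by
    rw [Finset.sum_comm]
    refine Finset.sum_congr rfl fun z _ => ?_
    rw [pow_two, ← hsum, Finset.sum_mul_sum]
    refine Finset.sum_congr rfl fun x _ => ?_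
    refine Finset.sum_congr rfl fun y _ => ?_
    simp only [Finset.sum_ite_eq, Finset.mem_univ, if_true]
    rw [hsymm y z, hsymm x z]
    linear_combination (hsq z x) * (a z y * a z y) + a z x * hsq z y
  have h5 : ∑ x, ∑ z, ∑ y, ∑ w, (if z = w then if x = y then a x z * a z y * a y w * a w x else 0 else 0)
      = ∑ x, (G.degree x : ℝ) := by
    refine Finset.sum_congr rfl fun x _ => ?_
    rw [← hsum]
    refine Finset.sum_congr rfl fun z _ => ?_
    simp only [Finset.sum_ite_eq, Finset.mem_univ, if_true]
    rw [hsymm z x]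
    simp only [hsq]
  have h6 : 2 * ∑ x, (G.degree x : ℝ)^2 = ∑ x, (G.degree x : ℝ)^2 + ∑ x, (G.degree x : ℝ)^2 := by ring
  rw [h6, h1, h2]
  nth_rewrite 1 [← h3]
  rw [← h4, ← h5]
  simp only [← Finset.sum_add_distrib, ← Finset.sum_sub_distrib]
  refine Finset.sum_congr rfl fun x _ => Finset.sum_congr rfl fun z _ =>
      Finset.sum_congr rfl fun y _ => Finset.sum_congr rfl fun w _ => ?_
  by_cases h1 : x = y <;> by_cases h2 : z = w <;> simp [h1, h2]


lemma pnk_adj (n k : ℕ) (x y : Fin n) : (PnK n k).Adj x y ↔ (x : ℕ) ≠ y ∧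
    ((((y : ℕ) = x + 1 ∧ (x : ℕ) + 1 ≠ n - k) ∨ ((x : ℕ) = 0 ∧ (y : ℕ) = n - k - 1) ∨
      ((x : ℕ) = 0 ∧ (y : ℕ) = n - k)) ∨
    (((x : ℕ) = y + 1 ∧ (y : ℕ) + 1 ≠ n - k) ∨ ((y : ℕ) = 0 ∧ (x : ℕ) = n - k - 1) ∨
      ((y : ℕ) = 0 ∧ (x : ℕ) = n - k))) := by
  simp only [PnK, SimpleGraph.fromRel_adj, ne_eq, Fin.ext_iff]
  have := x.2
  have := y.2
  constructor
  · rintro ⟨h, h'⟩; exact ⟨h, by omega⟩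
  · rintro ⟨h, h'⟩; exact ⟨h, by omega⟩

lemma degree_of_two {V : Type*} [Fintype V] (G : SimpleGraph V) (x a b : V) (hab : a ≠ b)
    (h : ∀ y, G.Adj x y ↔ y = a ∨ y = b) : G.degree x = 2 := by
  rw [← SimpleGraph.card_neighborFinset_eq_degree, ← Finset.card_pair hab]
  congr 1; ext y; simp [h]

lemma degree_of_one {V : Type*} [Fintype V] (G : SimpleGraph V) (x a : V)
    (h : ∀ y, G.Adj x y ↔ y = a) : G.degree x = 1 := by
  rw [← SimpleGraph.card_neighborFinset_eq_degree, ← Finset.card_singleton a]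
  congr 1; ext y; simp [h]

lemma degree_of_three {V : Type*} [Fintype V] (G : SimpleGraph V) (x a b c : V) (hab : a ≠ b)
    (hac : a ≠ c) (hbc : b ≠ c)
    (h : ∀ y, G.Adj x y ↔ y = a ∨ y = b ∨ y = c) : G.degree x = 3 := by
  rw [← SimpleGraph.card_neighborFinset_eq_degree, ← Finset.card_eq_three.2 ⟨a, b, c, hab, hac, hbc, rfl⟩]
  congr 1; ext y; simp [h]

lemma pnk_degree (n k : ℕ) (hk : k + 3 ≤ n) (x : Fin n) :
    (PnK n k).degree x = if k = 0 then 2 else if (x : ℕ) = 0 then 3 else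
      if (x : ℕ) = n - 1 then 1 else 2 := by
  have hx := x.2
  have key2 : ∀ a b : ℕ, ∀ (ha : a < n) (hb : b < n), a ≠ b →
      (∀ y : Fin n, (PnK n k).Adj x y ↔ (y : ℕ) = a ∨ (y : ℕ) = b) → (PnK n k).degree x = 2 := by
    intro a b ha hb hab h
    exact degree_of_two _ x ⟨a, ha⟩ ⟨b, hb⟩ (by simpa using hab) (by simpa [Fin.ext_iff] using h)
  by_cases h0 : (x : ℕ) = 0
  · by_cases hk0 : k = 0
    · rw [if_pos hk0]
      refine key2 1 (n - k - 1) (by omega) (by omega) (by omega) fun y => ?_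
      rw [pnk_adj]; have := y.2; omega
    · rw [if_neg hk0, if_pos h0]
      refine degree_of_three _ x ⟨1, by omega⟩ ⟨n - k - 1, by omega⟩ ⟨n - k, by omega⟩ ?_ ?_ ?_ fun y => ?_
      · simp; omega
      · simp; omega
      · simp; omega
      · rw [pnk_adj]; have := y.2; simp only [Fin.ext_iff]; omega
  by_cases h1 : (x : ℕ) = n - 1
  · by_cases hk0 : k = 0
    · rw [if_pos hk0]
      refine key2 0 (n - k - 2) (by omega) (by omega) (by omega) fun y => ?_
      rw [pnk_adj]; have := y.2; omega
    · rw [if_neg hk0, if_neg h0, if_pos h1]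
      by_cases hk1 : k = 1
      · refine degree_of_one _ x ⟨0, by omega⟩ fun y => ?_
        rw [pnk_adj]; have := y.2; simp only [Fin.ext_iff]; omega
      · refine degree_of_one _ x ⟨x - 1, by omega⟩ fun y => ?_
        rw [pnk_adj]; have := y.2; simp only [Fin.ext_iff]; omega
  have : (PnK n k).degree x = 2 := by
    by_cases h2 : (x : ℕ) = n - k - 1
    · refine key2 (x - 1) 0 (by omega) (by omega) (by omega) fun y => ?_
      rw [pnk_adj]; have := y.2; omega
    by_cases h3 : (x : ℕ) = n - k
    · refine key2 (x + 1) 0 (by omega) (by omega) (by omega) fun y => ?_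
      rw [pnk_adj]; have := y.2; omega
    · refine key2 (x + 1) (x - 1) (by omega) (by omega) (by omega) fun y => ?_
      rw [pnk_adj]; have := y.2; omega
  simp [this, h0, h1]

lemma pnk_sums (n k : ℕ) (hk : k + 3 ≤ n) :
    (∑ x, ((PnK n k).degree x : ℝ)) = 2 * n ∧ (∑ x, ((PnK n k).degree x : ℝ)^2) ≤ 4 * n + 2 := by
  by_cases hk0 : k = 0
  · simp only [pnk_degree n k hk, hk0]
    simp
    constructor <;> linarith
  · have h : ∀ x : Fin n, ((PnK n k).degree x : ℝ) =
        2 + (if x = ⟨0, by omega⟩ then 1 else 0) - (if x = ⟨n-1, by omega⟩ then 1 else 0) := by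
      intro x
      rw [pnk_degree n k hk]
      simp only [hk0, Fin.ext_iff, if_false]
      split_ifs <;> first | omega | norm_num
    have h2 : ∀ x : Fin n, ((PnK n k).degree x : ℝ)^2 =
        4 + (if x = ⟨0, by omega⟩ then 5 else 0) - (if x = ⟨n-1, by omega⟩ then 3 else 0) := by
      intro x
      rw [pnk_degree n k hk]
      simp only [hk0, Fin.ext_iff, if_false]
      split_ifs <;> first | omega | norm_num
    simp only [h2]
    simp only [h]
    simp only [Finset.sum_add_distrib, Finset.sum_sub_distrib, Finset.sum_ite_eq', Finset.mem_univ, if_true]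
    simp
    constructor <;> linarith

lemma pnk_edges (n k : ℕ) (hk : k + 3 ≤ n) : #(PnK n k).edgeFinset = n := by
  have h := (pnk_sums n k hk).1
  have h2 := (PnK n k).sum_degrees_eq_twice_card_edges
  have : ((∑ v, (PnK n k).degree v : ℕ) : ℝ) = 2 * n := by push_cast; exact h
  rw [h2] at this
  have : 2 * #(PnK n k).edgeFinset = 2 * n := by exact_mod_cast this
  omega

lemma pnk_nadj (n k : ℕ) (x y : Fin n) : (PnK n k).Adj x y ↔ nadj n k x y := by
  rw [pnk_adj, nadj]

lemma pnk_tri_zero (n k : ℕ) (hk : k + 3 < n) : triC (PnK n k) = 0 := by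
  rw [triC, Finset.card_eq_zero]
  refine Finset.eq_empty_of_forall_notMem ?_
  rintro ⟨x, y, z⟩ h
  simp only [pnk_nadj, mem_filter, mem_univ, true_and] at h
  have := (tri_aux n k x y z (by omega) h.1 h.2.1 h.2.2).1
  omega

lemma pnk_tri (n k : ℕ) (hk : k + 3 = n) : triC (PnK n k) ≤ 6 := by
  have : #({(0,1,2),(0,2,1),(1,0,2),(1,2,0),(2,0,1),(2,1,0)} : Finset (ℕ × ℕ × ℕ)) = 6 := by rfl
  rw [triC, ← this]
  refine Finset.card_le_card_of_injOn (fun t => (t.1.val, t.2.1.val, t.2.2.val)) ?_ ?_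
  · rintro ⟨x, y, z⟩ h
    simp only [pnk_nadj, coe_filter, Set.mem_ofPred_eq, mem_univ, true_and] at h
    have := tri_aux2 n k x y z hk h.1 h.2.1 h.2.2
    simp only [Finset.mem_coe]
    convert this
  · rintro ⟨x, y, z⟩ _ ⟨x', y', z'⟩ _ h
    simpa [Fin.ext_iff] using h

lemma pnk_quad_zero (n k : ℕ) (hk : k + 3 ≤ n) (h4 : k + 4 ≠ n) : quadC (PnK n k) = 0 := by
  rw [quadC, Finset.card_eq_zero]
  refine Finset.eq_empty_of_forall_notMem ?_
  rintro ⟨x, y, z, w⟩ h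
  simp only [pnk_nadj, mem_filter, mem_univ, true_and, ne_eq, Fin.ext_iff] at h
  obtain ⟨h1, h2, h3, h5, h6, h7⟩ := h
  have := (quad_aux n k x y z w (by omega) h1 h2 h3 h5 h6 h7).1
  omega

lemma pnk_quad (n k : ℕ) (hk : k + 4 = n) : quadC (PnK n k) ≤ 8 := by
  have : #({(0,1,2,3),(0,3,2,1),(1,2,3,0),(1,0,3,2),(2,3,0,1),(2,1,0,3),(3,0,1,2),(3,2,1,0)} :
    Finset (ℕ × ℕ × ℕ × ℕ)) = 8 := by rfl
  rw [quadC, ← this]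
  refine Finset.card_le_card_of_injOn (fun t => (t.1.val, t.2.1.val, t.2.2.1.val, t.2.2.2.val)) ?_ ?_
  · rintro ⟨x, y, z, w⟩ h
    simp only [pnk_nadj, coe_filter, Set.mem_ofPred_eq, mem_univ, true_and, ne_eq, Fin.ext_iff] at h
    obtain ⟨h1, h2, h3, h5, h6, h7⟩ := h
    have := quad_aux2 n k x y z w hk h1 h2 h3 h5 h6 h7
    simp only [Finset.mem_coe]
    convert this
  · rintro ⟨x, y, z, w⟩ _ ⟨x', y', z', w'⟩ _ h
    simpa [Fin.ext_iff] using h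

lemma tri_le {V : Type*} [Fintype V] (G : SimpleGraph V) (x y z : V) (h1 : G.Adj x y)
    (h2 : G.Adj y z) (h3 : G.Adj z x) : 6 ≤ triC G := by
  have e1 := h1.ne
  have e2 := h2.ne
  have e3 := h3.ne
  have : #({(x,y,z),(x,z,y),(y,x,z),(y,z,x),(z,x,y),(z,y,x)} : Finset (V × V × V)) = 6 := by
    repeat rw [Finset.card_insert_of_notMem (by simp [e1, e2, e3, e1.symm, e2.symm, e3.symm])]
    simp
  rw [triC, ← this]
  refine Finset.card_le_card ?_
  intro t ht
  simp only [mem_insert, mem_singleton] at ht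
  rcases ht with rfl | rfl | rfl | rfl | rfl | rfl <;>
    simp [h1, h2, h3, h1.symm, h2.symm, h3.symm]

lemma quad_le {V : Type*} [Fintype V] (G : SimpleGraph V) (x y z w : V) (h1 : G.Adj x y)
    (h2 : G.Adj y z) (h3 : G.Adj z w) (h4 : G.Adj w x) (h5 : x ≠ z) (h6 : y ≠ w) :
    8 ≤ quadC G := by
  have e1 := h1.ne
  have e2 := h2.ne
  have e3 := h3.ne
  have e4 := h4.ne
  have : #({(x,y,z,w),(x,w,z,y),(y,z,w,x),(y,x,w,z),(z,w,x,y),(z,y,x,w),(w,x,y,z),(w,z,y,x)} :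
      Finset (V × V × V × V)) = 8 := by
    repeat rw [Finset.card_insert_of_notMem (by
      simp [e1, e2, e3, e4, h5, h6, e1.symm, e2.symm, e3.symm, e4.symm, h5.symm, h6.symm])]
    simp
  rw [quadC, ← this]
  refine Finset.card_le_card ?_
  intro t ht
  simp only [mem_insert, mem_singleton] at ht
  rcases ht with rfl | rfl | rfl | rfl | rfl | rfl | rfl | rfl <;>
    simp [h1, h2, h3, h4, h5, h6, h1.symm, h2.symm, h3.symm, h4.symm, h5.symm, h6.symm]


lemma bridge_mem {V : Type*} {G : SimpleGraph V} (hc : G.Connected) {e : Sym2 V}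
    (he : G.IsBridge e) : e ∈ G.edgeSet := by
  induction e using Sym2.ind with
  | _ u v => exact he.reachable_iff_adj.1 (hc.preconnected u v)

lemma bridges_add_cycle {V : Type*} [Fintype V] {G : SimpleGraph V} (hc : G.Connected) {u : V}
    (c : G.Walk u u) (h : c.IsCycle) : numBridges G + c.length ≤ #G.edgeFinset := by
  have h1 : (c.edges.toFinset).card = c.length := by
    rw [List.toFinset_card_of_nodup h.edges_nodup, SimpleGraph.Walk.length_edges]
  have h2 : numBridges G = #(univ.filter fun e : Sym2 V => G.IsBridge e) := by
    rw [numBridges, ← Set.ncard_coe_finset]; simp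
  rw [h2, ← h1, ← Finset.card_union_of_disjoint]
  · refine Finset.card_le_card ?_
    intro e he
    simp only [mem_union, mem_filter, mem_univ, true_and, List.mem_toFinset] at he
    rw [SimpleGraph.mem_edgeFinset]
    rcases he with he | he
    · exact bridge_mem hc he
    · exact c.edges_subset_edgeSet he
  · rw [Finset.disjoint_left]
    intro e he he'
    simp only [mem_filter, mem_univ, true_and, List.mem_toFinset] at he he'
    exact he.notMem_edges_of_isCycle h he'

lemma not_tree {n k : ℕ} (hk : k + 3 ≤ n) (G : SimpleGraph (Fin n)) (hconn : G.Connected)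
    (hbr : numBridges G = k) : ¬ G.IsTree := by
  intro ht
  have h1 := ht.card_edgeFinset
  have h2 := SimpleGraph.isAcyclic_iff_forall_isBridge.1 ht.isAcyclic
  have h3 : {e : Sym2 (Fin n) | G.IsBridge e} = G.edgeFinset := by
    ext e; simp only [Set.mem_ofPred_eq, SimpleGraph.coe_edgeFinset]
    exact ⟨bridge_mem hconn, fun h => h2 h⟩
  rw [numBridges, h3, Set.ncard_coe_finset] at hbr
  simp at h1
  omega

lemma le_edges {n k : ℕ} (hk : k + 3 ≤ n) (G : SimpleGraph (Fin n)) (hconn : G.Connected)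
    (hbr : numBridges G = k) : n ≤ #G.edgeFinset := by
  have h1 := not_tree hk G hconn hbr
  rw [SimpleGraph.isTree_iff_connected_and_card] at h1
  have h2 := hconn.card_vert_le_card_edgeSet_add_one
  simp only [Nat.card_eq_fintype_card, Fintype.card_fin, ← SimpleGraph.edgeFinset_card] at h1 h2
  have : ¬ (#G.edgeFinset + 1 = n) := fun h => h1 ⟨hconn, h⟩
  omega

lemma exists_cycle {n k : ℕ} (hk : k + 3 ≤ n) (G : SimpleGraph (Fin n)) (hconn : G.Connected)
    (hbr : numBridges G = k) (hm : #G.edgeFinset = n) :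
    ∃ (u : Fin n) (c : G.Walk u u), c.IsCycle ∧ c.length ≤ n - k := by
  have h1 := not_tree hk G hconn hbr
  have h2 : ¬ G.IsAcyclic := fun h => h1 ⟨hconn, h⟩
  unfold SimpleGraph.IsAcyclic at h2
  push Not at h2
  obtain ⟨u, c, hc⟩ := h2
  have := bridges_add_cycle hconn c hc
  exact ⟨u, c, hc, by omega⟩

lemma cycle_tri {V : Type*} [Fintype V] {G : SimpleGraph V} {u : V} (c : G.Walk u u)
    (hl : c.length = 3) : 6 ≤ triC G := by
  have h0 := c.adj_getVert_succ (i := 0) (by omega)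
  have h1 := c.adj_getVert_succ (i := 1) (by omega)
  have h2 := c.adj_getVert_succ (i := 2) (by omega)
  have h3 : c.getVert (2+1) = c.getVert 0 := by
    rw [show 2 + 1 = c.length by omega]; simp
  rw [h3] at h2
  exact tri_le G _ _ _ h0 h1 h2

lemma cycle_quad {V : Type*} [Fintype V] {G : SimpleGraph V} {u : V} (c : G.Walk u u)
    (hc : c.IsCycle) (hl : c.length = 4) : 8 ≤ quadC G := by
  have h0 := c.adj_getVert_succ (i := 0) (by omega)
  have h1 := c.adj_getVert_succ (i := 1) (by omega)
  have h2 := c.adj_getVert_succ (i := 2) (by omega)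
  have h3 := c.adj_getVert_succ (i := 3) (by omega)
  have h4 : c.getVert (3+1) = c.getVert 0 := by
    rw [show 3 + 1 = c.length by omega]; simp
  rw [h4] at h3
  refine quad_le G _ _ _ _ h0 h1 h2 h3 ?_ ?_
  · intro h
    have := hc.getVert_injOn' (show 0 ∈ _ by simp) (show 2 ∈ _ by simp; omega) h
    omega
  · intro h
    have := hc.getVert_injOn' (show 1 ∈ _ by simp; omega) (show 3 ∈ _ by simp; omega) h
    omega

/-- comparison of third moments and quadrilateral counts -/
lemma compare_counts {n k : ℕ} (hk : k + 3 ≤ n) (G : SimpleGraph (Fin n)) (hconn : G.Connected)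
    (hbr : numBridges G = k) (hm : #G.edgeFinset = n) :
    triC (PnK n k) < triC G ∨ (triC (PnK n k) = triC G ∧ quadC (PnK n k) ≤ quadC G) := by
  obtain ⟨u, c, hc, hl⟩ := exists_cycle hk G hconn hbr hm
  have h3 := hc.three_le_length
  by_cases e3 : k + 3 = n
  · have h6 := cycle_tri c (by omega)
    have h7 := pnk_tri n k e3
    have h8 := pnk_quad_zero n k hk (by omega)
    omega
  have t0 := pnk_tri_zero n k (by omega)
  by_cases e4 : k + 4 = n
  · have h7 := pnk_quad n k e4
    by_cases l3 : c.length = 3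
    · have h6 := cycle_tri c l3
      omega
    · have h6 := cycle_quad c hc (by omega)
      omega
  · have h8 := pnk_quad_zero n k hk e4
    omega


lemma deg_dichotomy {V : Type*} [Fintype V] (f : V → ℤ) (h0 : ∑ v, f v = 0)
    (h2 : ∑ v, f v ^ 2 ≤ 2) :
    (∀ v, f v = 0) ∨ ∃ a c, f a = -1 ∧ f c = 1 ∧ ∀ v, v ≠ a → v ≠ c → f v = 0 := by
  by_cases hall : ∀ v, f v = 0
  · exact Or.inl hall
  right
  push Not at hall
  obtain ⟨v, hv⟩ := hall
  obtain ⟨c, -, hc⟩ : ∃ i ∈ univ, 0 < f i :=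
    Finset.exists_pos_of_sum_zero_of_exists_nonzero f h0 ⟨v, mem_univ _, hv⟩
  obtain ⟨a, -, ha⟩ : ∃ i ∈ univ, 0 < (-f i) :=
    Finset.exists_pos_of_sum_zero_of_exists_nonzero (fun i => - f i) (by simp [h0])
      ⟨v, mem_univ _, by simpa using hv⟩
  have hac : a ≠ c := by rintro rfl; omega
  have hle : ∀ s : Finset V, ∑ v ∈ s, f v ^ 2 ≤ 2 := fun s =>
    (Finset.sum_le_sum_of_subset_of_nonneg (Finset.subset_univ s)
      (fun i _ _ => sq_nonneg _)).trans h2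
  have h1 := hle {a, c}
  rw [Finset.sum_pair hac] at h1
  refine ⟨a, c, by nlinarith, by nlinarith, fun x hxa hxc => ?_⟩
  have h3 := hle {x, a, c}
  rw [Finset.sum_insert (by simp [hxa, hxc]), Finset.sum_pair hac] at h3
  have : f x ^ 2 ≤ 0 := by nlinarith
  exact pow_eq_zero_iff (two_ne_zero) |>.1 (le_antisymm this (sq_nonneg _))

lemma exists_max_path {V : Type*} [Fintype V] (G : SimpleGraph V) (v0 : V) :
    ∃ (w : V) (p : G.Walk v0 w), p.IsPath ∧ ∀ y, G.Adj w y → y ∈ p.support := by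
  by_contra hcon
  push Not at hcon
  have : ∀ l : ℕ, ∃ (w : V) (p : G.Walk v0 w), p.IsPath ∧ p.length = l := by
    intro l
    induction l with
    | zero => exact ⟨v0, SimpleGraph.Walk.nil, by simp, rfl⟩
    | succ l ih =>
      obtain ⟨w, p, hp, hl⟩ := ih
      obtain ⟨y, hy, hys⟩ := hcon w p hp
      exact ⟨y, p.concat hy, hp.concat hys hy, by simp [hl]⟩
  obtain ⟨w, p, hp, hl⟩ := this (Fintype.card V)
  have := hp.length_lt
  omega

lemma le_degree {V : Type*} [Fintype V] (G : SimpleGraph V) (x : V) (s : Finset V)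
    (h : ∀ y ∈ s, G.Adj x y) : #s ≤ G.degree x := by
  rw [← SimpleGraph.card_neighborFinset_eq_degree]
  refine Finset.card_le_card fun y hy => ?_
  simpa using h y hy

lemma two_le_degree {V : Type*} [Fintype V] (G : SimpleGraph V) (x a b : V) (hab : a ≠ b)
    (ha : G.Adj x a) (hb : G.Adj x b) : 2 ≤ G.degree x := by
  rw [← Finset.card_pair hab]
  exact le_degree G x _ (by simp [ha, hb])

lemma three_le_degree {V : Type*} [Fintype V] (G : SimpleGraph V) (x a b c : V) (hab : a ≠ b)
    (hac : a ≠ c) (hbc : b ≠ c)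
    (ha : G.Adj x a) (hb : G.Adj x b) (hc : G.Adj x c) : 3 ≤ G.degree x := by
  rw [← Finset.card_eq_three.2 ⟨a, b, c, hab, hac, hbc, rfl⟩]
  exact le_degree G x _ (by simp [ha, hb, hc])

lemma four_le_degree {V : Type*} [Fintype V] (G : SimpleGraph V) (x a b c d : V) (hab : a ≠ b)
    (hac : a ≠ c) (hbc : b ≠ c) (had : a ≠ d) (hbd : b ≠ d) (hcd : c ≠ d)
    (ha : G.Adj x a) (hb : G.Adj x b) (hc : G.Adj x c) (hd : G.Adj x d) : 4 ≤ G.degree x := by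
  have : #({a, b, c, d} : Finset V) = 4 := by
    rw [Finset.card_insert_of_notMem (by simp [hab, hac, had]),
      Finset.card_eq_three.2 ⟨b, c, d, hbc, hbd, hcd, rfl⟩]
  rw [← this]
  exact le_degree G x _ (by simp [ha, hb, hc, hd])

lemma ham_path {V : Type*} [Fintype V] (G : SimpleGraph V) (hconn : G.Connected)
    (hn : 2 ≤ Fintype.card V) (v0 : V)
    (hd : (∀ v, G.degree v = 2) ∨ ∃ c, G.degree v0 = 1 ∧ G.degree c = 3 ∧
      ∀ v, v ≠ v0 → v ≠ c → G.degree v = 2) :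
    ∃ (w : V) (p : G.Walk v0 w) (i : ℕ), p.IsPath ∧ p.length + 1 = Fintype.card V ∧
      i + 2 ≤ p.length ∧ G.Adj w (p.getVert i) := by
  obtain ⟨w, p, hp, hmax⟩ := exists_max_path G v0
  have hinj : ∀ a b, a ≤ p.length → b ≤ p.length → p.getVert a = p.getVert b → a = b :=
    fun a b ha hb h => hp.getVert_injOn ha hb h
  have hne : ∀ a b, a ≤ p.length → b ≤ p.length → a ≠ b → p.getVert a ≠ p.getVert b :=
    fun a b ha hb h h' => h (hinj a b ha hb h')
  have hlast : p.getVert p.length = w := p.getVert_length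
  have hfirst : p.getVert 0 = v0 := p.getVert_zero
  have hL : 1 ≤ p.length := by
    by_contra hL
    have hL0 : p.length = 0 := by omega
    have hw : w = v0 := by rw [← hlast, hL0, hfirst]
    have : Nontrivial V := Fintype.one_lt_card_iff_nontrivial.1 (by omega)
    obtain ⟨y, hy⟩ := hconn.preconnected.exists_adj_of_nontrivial w
    have := hmax y hy
    obtain ⟨j, hj, hjl⟩ := SimpleGraph.Walk.mem_support_iff_exists_getVert.1 this
    have : j = 0 := by omega
    rw [this, hfirst, ← hw] at hj
    exact hy.ne hj
  have hwv0 : w ≠ v0 := by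
    intro h
    exact hne p.length 0 le_rfl (by omega) (by omega) (by rw [hlast, hfirst, h])
  have hdw : 2 ≤ G.degree w := by
    rcases hd with hd | ⟨c, h1, h3, h2⟩
    · exact (hd w).ge
    · by_cases hwc : w = c
      · rw [hwc, h3]; norm_num
      · exact (h2 w hwv0 hwc).ge
  have hprev : ∀ j, 0 < j → j ≤ p.length → G.Adj (p.getVert j) (p.getVert (j-1)) := by
    intro j hj hjl
    have := (p.adj_getVert_succ (i := j-1) (by omega)).symm
    rwa [show j - 1 + 1 = j by omega] at this
  have hnext : ∀ j, j < p.length → G.Adj (p.getVert j) (p.getVert (j+1)) :=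
    fun j hj => p.adj_getVert_succ hj
  -- second neighbour of w
  obtain ⟨y, hy, hyne⟩ : ∃ y, G.Adj w y ∧ y ≠ p.getVert (p.length - 1) := by
    rw [← SimpleGraph.card_neighborFinset_eq_degree] at hdw
    obtain ⟨y, hy, hyne⟩ := Finset.exists_mem_ne (s := G.neighborFinset w) (by omega) (p.getVert (p.length - 1))
    exact ⟨y, by simpa using hy, hyne⟩
  obtain ⟨i, rfl, hil⟩ := SimpleGraph.Walk.mem_support_iff_exists_getVert.1 (hmax y hy)
  have hi1 : i ≠ p.length := by
    rintro rfl; rw [hlast] at hy; exact hy.ne rfl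
  have hi2 : i ≠ p.length - 1 := by
    rintro rfl; exact hyne rfl
  refine ⟨w, p, i, hp, ?_, by omega, hy⟩
  have hcover : ∀ v, v ∈ p.support := by
    by_contra hcon
    push Not at hcon
    obtain ⟨v, hv⟩ := hcon
    obtain ⟨q⟩ := hconn.preconnected v0 v
    obtain ⟨d, -, hd1, hd2⟩ := q.exists_boundary_dart {x | x ∈ p.support} (by simp) hv
    obtain ⟨j, hj, hjl⟩ := SimpleGraph.Walk.mem_support_iff_exists_getVert.1 hd1
    have hadj := d.adj
    rw [← hj] at hadj
    generalize d.toProd.2 = z at *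
    have hzne : ∀ a, p.getVert a ≠ z := by
      rintro a rfl; exact hd2 (p.getVert_mem_support a)
    have hjL : j ≠ p.length := by
      rintro rfl; rw [hlast] at hadj; exact hd2 (hmax _ hadj)
    have hwi : G.Adj (p.getVert i) (p.getVert p.length) := by rw [hlast]; exact hy.symm
    have hi3 : 0 < i → 3 ≤ G.degree (p.getVert i) := fun hi0 =>
      three_le_degree G _ _ _ _ (hne (i-1) (i+1) (by omega) (by omega) (by omega))
        (hne (i-1) p.length (by omega) (by omega) (by omega))
        (hne (i+1) p.length (by omega) (by omega) (by omega)) (hprev i hi0 hil)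
        (hnext i (by omega)) hwi
    have hle3 : ∀ v, G.degree v ≤ 3 := by
      intro v
      rcases hd with hd | ⟨c, h1, h3, h2⟩
      · rw [hd v]; norm_num
      · by_cases e1 : v = v0
        · rw [e1, h1]; norm_num
        by_cases e2 : v = c
        · rw [e2, h3]
        · rw [h2 v e1 e2]; norm_num
    have huniq : ∀ u v, 3 ≤ G.degree u → 3 ≤ G.degree v → u = v := by
      intro u v hu hv
      rcases hd with hd | ⟨c, h1, h3, h2⟩
      · have := hd u; omega
      · have : ∀ u, 3 ≤ G.degree u → u = c := by
          intro u hu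
          by_contra e2
          by_cases e1 : u = v0
          · rw [e1] at hu; omega
          · have := h2 u e1 e2; omega
        rw [this u hu, this v hv]
    have hv0 : 2 ≤ G.degree v0 → ∀ v, G.degree v = 2 := by
      intro h
      rcases hd with hd | ⟨c, h1, h3, h2⟩
      · exact hd
      · omega
    by_cases hj0 : j = 0
    · subst hj0
      have h2 := hv0 (by
        rw [← hfirst]
        exact two_le_degree G _ _ _ (hzne 1) (hnext 0 (by omega)) hadj)
      by_cases hi0 : i = 0
      · subst hi0
        have := three_le_degree G _ _ _ _ (hne 1 p.length (by omega) (by omega) (by omega))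
          (hzne 1) (hzne _) (hnext 0 (by omega)) hwi hadj
        rw [h2] at this; omega
      · have := hi3 (by omega)
        rw [h2] at this; omega
    · have hj3 : 3 ≤ G.degree (p.getVert j) :=
        three_le_degree G _ _ _ _ (hne (j-1) (j+1) (by omega) (by omega) (by omega))
          (hzne _) (hzne _) (hprev j (by omega) hjl) (hnext j (by omega)) hadj
      by_cases hi0 : i = 0
      · subst hi0
        have h2 := hv0 (by
          rw [← hfirst]
          exact two_le_degree G _ _ _ (hne 1 p.length (by omega) (by omega) (by omega))
            (hnext 0 (by omega)) hwi)
        rw [h2] at hj3; omega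
      · have hij := hinj _ _ hjl hil (huniq _ _ hj3 (hi3 (by omega)))
        subst hij
        have := four_le_degree G _ _ _ _ _ (hne (j-1) (j+1) (by omega) (by omega) (by omega))
          (hne (j-1) p.length (by omega) (by omega) (by omega))
          (hne (j+1) p.length (by omega) (by omega) (by omega)) (hzne _) (hzne _) (hzne _)
          (hprev j (by omega) hjl) (hnext j (by omega)) hwi hadj
        have := hle3 (p.getVert j)
        omega
  have h1 : p.support.toFinset = univ := by
    ext v; simp [hcover v]
  have h2 := List.toFinset_card_of_nodup hp.support_nodup
  rw [h1, SimpleGraph.Walk.length_support, Finset.card_univ] at h2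
  exact h2.symm


lemma lollipop_iso {n : ℕ} (G : SimpleGraph (Fin n)) (hm : #G.edgeFinset = n) {v0 w : Fin n}
    (p : G.Walk v0 w) (i : ℕ) (hp : p.IsPath) (hl : p.length + 1 = n) (hi : i + 2 ≤ p.length)
    (hw : G.Adj w (p.getVert i)) : Nonempty (PnK n i ≃g G) := by
  set r : ℕ → ℕ := fun x => if x ≤ n - 1 - i then x + i else n - 1 - x with hr
  have hinj : Function.Injective (fun x : Fin n => p.getVert (r x)) := by
    intro x y h
    have hx := x.2
    have hy := y.2
    have hrx : r x ≤ p.length := by simp only [hr]; split_ifs <;> omega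
    have hry : r y ≤ p.length := by simp only [hr]; split_ifs <;> omega
    have := hp.getVert_injOn hrx hry h
    simp only [hr] at this
    ext
    split_ifs at this <;> omega
  let e : Fin n ≃ Fin n := Equiv.ofBijective _ (Finite.injective_iff_bijective.1 hinj)
  have he : ∀ x, e x = p.getVert (r x) := fun x => rfl
  have hnext : ∀ a b, b = a + 1 → b ≤ p.length → G.Adj (p.getVert a) (p.getVert b) := by
    rintro a b rfl hb; exact p.adj_getVert_succ (by omega)
  have hlast : p.getVert p.length = w := p.getVert_length
  have hrel : ∀ x y : Fin n, (((y : ℕ) = x + 1 ∧ (x : ℕ) + 1 ≠ n - i) ∨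
      ((x : ℕ) = 0 ∧ (y : ℕ) = n - i - 1) ∨ ((x : ℕ) = 0 ∧ (y : ℕ) = n - i)) →
      G.Adj (e x) (e y) := by
    intro x y h
    have hx := x.2
    have hy := y.2
    rw [he, he]
    rcases h with ⟨h1, h2⟩ | ⟨h1, h2⟩ | ⟨h1, h2⟩
    · by_cases hc : (y : ℕ) ≤ n - 1 - i
      · have e1 : r x = x + i := by simp only [hr]; rw [if_pos (by omega)]
        have e2 : r y = y + i := by simp only [hr]; rw [if_pos (by omega)]
        rw [e1, e2]
        exact hnext _ _ (by omega) (by omega)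
      · have e1 : r x = n - 1 - x := by simp only [hr]; rw [if_neg (by omega)]
        have e2 : r y = n - 1 - y := by simp only [hr]; rw [if_neg (by omega)]
        rw [e1, e2]
        exact (hnext _ _ (by omega) (by omega)).symm
    · have e1 : r x = i := by simp only [hr]; rw [if_pos (by omega)]; omega
      have e2 : r y = p.length := by simp only [hr]; rw [if_pos (by omega)]; omega
      rw [e1, e2, hlast]
      exact hw.symm
    · have e1 : r x = i := by simp only [hr]; rw [if_pos (by omega)]; omega
      have e2 : r y = n - 1 - y := by simp only [hr]; rw [if_neg (by omega)]
      rw [e1, e2]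
      exact (hnext _ _ (by omega) (by omega)).symm
  have hle : (PnK n i).map e.toEmbedding ≤ G := by
    rw [SimpleGraph.map_le_iff_le_comap]
    intro x y hxy
    rw [pnk_adj] at hxy
    rcases hxy with ⟨-, h | h⟩
    · exact hrel x y h
    · exact (hrel y x h).symm
  have heq : (PnK n i).map e.toEmbedding = G := by
    rw [← SimpleGraph.edgeFinset_inj]
    refine Finset.eq_of_subset_of_card_le (SimpleGraph.edgeFinset_subset_edgeFinset.2 hle) ?_
    have h1 := SimpleGraph.card_edgeFinset_map e.toEmbedding (PnK n i)
    have h2 := pnk_edges n i (by omega)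
    rw [hm]
    refine le_of_eq ?_
    have h3 := (h1.trans (by convert h2)).symm
    convert h3
  have := SimpleGraph.Iso.map e (PnK n i)
  have heq' : (PnK n i).map e = G := heq
  rw [heq'] at this
  exact ⟨this⟩

lemma lollipop_le {n : ℕ} (G : SimpleGraph (Fin n)) (hconn : G.Connected)
    (hm : #G.edgeFinset = n) {v0 w : Fin n}
    (p : G.Walk v0 w) (i : ℕ) (hp : p.IsPath) (hl : p.length + 1 = n) (hi : i + 2 ≤ p.length)
    (hw : G.Adj w (p.getVert i)) : numBridges G ≤ i := by
  have hc : (SimpleGraph.Walk.cons hw (p.drop i)).IsCycle := by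
    rw [SimpleGraph.Walk.cons_isCycle_iff]
    refine ⟨hp.drop i, ?_⟩
    rw [SimpleGraph.Walk.mk_mem_edges_iff_exists]
    rintro ⟨j, hj, h⟩
    have hlast : p.getVert p.length = w := p.getVert_length
    simp only [SimpleGraph.Walk.drop_getVert, SimpleGraph.Walk.drop_length, ← hlast] at h hj
    have hinj : ∀ a b, a ≤ p.length → b ≤ p.length → p.getVert a = p.getVert b → a = b :=
      fun a b ha hb h => hp.getVert_injOn ha hb h
    rcases Sym2.eq_iff.1 h with ⟨h1, h2⟩ | ⟨h1, h2⟩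
    · have := hinj _ _ (by omega) (by omega) h1
      omega
    · have := hinj _ _ (by omega) (by omega) h1
      have := hinj _ _ (by omega) (by omega) h2
      omega
  have := bridges_add_cycle hconn _ hc
  simp only [SimpleGraph.Walk.length_cons, SimpleGraph.Walk.drop_length] at this
  omega

lemma le_lollipop {n i : ℕ} (hi : i + 3 ≤ n) (G : SimpleGraph (Fin n)) (φ : PnK n i ≃g G) :
    i ≤ numBridges G := by
  let par : ℕ → Fin n := fun t => ⟨if t = n - i then 0 else min (t - 1) (n - 1), by
    split_ifs <;> omega⟩
  let cur : ℕ → Fin n := fun t => ⟨min t (n-1), by omega⟩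
  have hb : ∀ t, n - i ≤ t → t < n → G.IsBridge s(φ (cur t), φ (par t)) := by
    intro t h1 h2
    rw [SimpleGraph.isBridge_iff]
    rintro ⟨q⟩
    obtain ⟨d, -, hd1, hd2⟩ := q.exists_boundary_dart {x | t ≤ ((φ.symm x : Fin n) : ℕ)}
      (by simp [cur]; omega) (by simp [par]; split_ifs <;> omega)
    have hadj := d.adj
    rw [SimpleGraph.deleteEdges_adj] at hadj
    obtain ⟨ha, hne⟩ := hadj
    have ha' := φ.symm.map_rel_iff.2 ha
    rw [pnk_adj] at ha'
    simp only [Set.mem_ofPred_eq, not_le] at hd1 hd2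
    apply hne
    have e1 : φ.symm d.fst = cur t := by
      ext; simp only [cur]; omega
    have e2 : φ.symm d.snd = par t := by
      ext; simp only [par]; split_ifs <;> omega
    have e3 : d.fst = φ (cur t) := (φ.apply_symm_apply _).symm.trans (congrArg φ e1)
    have e4 : d.snd = φ (par t) := (φ.apply_symm_apply _).symm.trans (congrArg φ e2)
    exact Set.mem_singleton_iff.2 (Sym2.eq_iff.2 (Or.inl ⟨e3, e4⟩))
  rw [numBridges]
  have hsub : ((Finset.Ico (n - i) n).image fun t => s(φ (cur t), φ (par t)) : Finset _) ⊆
      (univ.filter fun e => G.IsBridge e) := by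
    intro e he
    simp only [mem_image, Finset.mem_Ico] at he
    obtain ⟨t, ⟨h1, h2⟩, rfl⟩ := he
    simpa using hb t h1 h2
  have h2 : {e : Sym2 (Fin n) | G.IsBridge e}.ncard = #(univ.filter fun e => G.IsBridge e) := by
    rw [← Set.ncard_coe_finset]; simp
  rw [h2]
  refine le_trans ?_ (Finset.card_le_card hsub)
  rw [Finset.card_image_of_injOn]
  · simp; omega
  · intro t ht t' ht' h
    simp only [coe_Ico, Set.mem_Ico] at ht ht'
    simp only [Sym2.eq_iff, EmbeddingLike.apply_eq_iff_eq, Fin.ext_iff, cur, par] at h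
    split_ifs at h <;> omega


lemma iso_of_small {n k : ℕ} (hk : k + 3 ≤ n) (G : SimpleGraph (Fin n)) (hconn : G.Connected)
    (hbr : numBridges G = k) (hm : #G.edgeFinset = n)
    (hs : ∑ v, G.degree v ^ 2 ≤ 4 * n + 2) : Nonempty (G ≃g PnK n k) := by
  have hsum : ∑ v, G.degree v = 2 * n := by rw [G.sum_degrees_eq_twice_card_edges, hm]
  have h0 : ∑ v, ((G.degree v : ℤ) - 2) = 0 := by
    rw [Finset.sum_sub_distrib, ← Nat.cast_sum, hsum]
    simp; ring
  have h2 : ∑ v, ((G.degree v : ℤ) - 2) ^ 2 ≤ 2 := by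
    have e : ∀ v, ((G.degree v : ℤ) - 2) ^ 2 = (G.degree v : ℤ) ^ 2 - 4 * ((G.degree v : ℤ) - 2) - 4 :=
      fun v => by ring
    simp only [e, Finset.sum_sub_distrib, ← Finset.mul_sum]
    rw [← Finset.sum_sub_distrib, h0]
    have : ((∑ v, G.degree v ^ 2 : ℕ) : ℤ) ≤ 4 * n + 2 := by exact_mod_cast hs
    push_cast at this
    simp
    linarith
  have hd : ∃ v0, (∀ v, G.degree v = 2) ∨ ∃ c, G.degree v0 = 1 ∧ G.degree c = 3 ∧
      ∀ v, v ≠ v0 → v ≠ c → G.degree v = 2 := by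
    rcases deg_dichotomy _ h0 h2 with h | ⟨a, c, ha, hc, h⟩
    · exact ⟨⟨0, by omega⟩, Or.inl fun v => by have := h v; omega⟩
    · refine ⟨a, Or.inr ⟨c, by omega, by omega, fun v h1 h2 => by have := h v h1 h2; omega⟩⟩
  obtain ⟨v0, hd⟩ := hd
  obtain ⟨w, p, i, hp, hl, hi, hw⟩ := ham_path G hconn (by simp; omega) v0 hd
  rw [Fintype.card_fin] at hl
  obtain ⟨φ⟩ := lollipop_iso G hm p i hp hl hi hw
  have h3 := lollipop_le G hconn hm p i hp hl hi hw
  have h4 := le_lollipop (by omega) G φ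
  have : i = k := by omega
  subst this
  exact ⟨φ.symm⟩

lemma small_four (G : SimpleGraph (Fin 4)) (hs : ∑ v, G.degree v = 8) :
    ∑ v, G.degree v ^ 2 ≤ 18 := by
  have hdeg : ∀ x, G.degree x = ∑ y, if G.Adj x y then 1 else 0 := by
    intro x
    simp [← SimpleGraph.card_neighborFinset_eq_degree, SimpleGraph.neighborFinset_eq_filter]
  have hs1 : G.Adj 1 0 ↔ G.Adj 0 1 := G.adj_comm _ _
  have hs2 : G.Adj 2 0 ↔ G.Adj 0 2 := G.adj_comm _ _
  have hs3 : G.Adj 3 0 ↔ G.Adj 0 3 := G.adj_comm _ _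
  have hs4 : G.Adj 2 1 ↔ G.Adj 1 2 := G.adj_comm _ _
  have hs5 : G.Adj 3 1 ↔ G.Adj 1 3 := G.adj_comm _ _
  have hs6 : G.Adj 3 2 ↔ G.Adj 2 3 := G.adj_comm _ _
  simp only [hdeg, Fin.sum_univ_four, hs1, hs2, hs3, hs4, hs5, hs6, SimpleGraph.irrefl] at hs ⊢
  by_cases h1 : G.Adj 0 1 <;> by_cases h2 : G.Adj 0 2 <;> by_cases h3 : G.Adj 0 3 <;>
  by_cases h4 : G.Adj 1 2 <;> by_cases h5 : G.Adj 1 3 <;> by_cases h6 : G.Adj 2 3 <;>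
    simp [h1, h2, h3, h4, h5, h6] at hs ⊢

lemma five_le {n k : ℕ} (hk : k + 3 ≤ n) (G : SimpleGraph (Fin n)) (hm : #G.edgeFinset = n)
    (hs : 4 * n + 2 < ∑ v, G.degree v ^ 2) : 5 ≤ n := by
  have hsum : ∑ v, G.degree v = 2 * n := by rw [G.sum_degrees_eq_twice_card_edges, hm]
  by_contra hn
  obtain h | h : n = 3 ∨ n = 4 := by omega
  · subst h
    have : ∑ v, G.degree v ^ 2 ≤ ∑ v, 2 * G.degree v := by
      refine Finset.sum_le_sum fun v _ => ?_
      have := G.degree_lt_card_verts v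
      simp only [Fintype.card_fin] at this
      rw [pow_two]
      exact Nat.mul_le_mul_right _ (by omega)
    rw [← Finset.mul_sum, hsum] at this
    omega
  · subst h
    have := small_four G hsum
    omega

lemma main_aux {n k : ℕ} (hk : k + 3 ≤ n) (G : SimpleGraph (Fin n)) (hconn : G.Connected)
    (hbr : numBridges G = k) (hne : ¬ Nonempty (G ≃g PnK n k)) : SLt n (PnK n k) G := by
  have hP := pnk_sums n k hk
  have hG2 : ∑ v, (G.degree v : ℝ) = 2 * (#G.edgeFinset : ℝ) := by
    exact_mod_cast G.sum_degrees_eq_twice_card_edges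
  have s0 : specMoment (PnK n k) 0 = specMoment G 0 := by rw [specMoment_zero, specMoment_zero]
  have s1 : specMoment (PnK n k) 1 = specMoment G 1 := by rw [specMoment_one, specMoment_one]
  have hle := le_edges hk G hconn hbr
  rcases hle.lt_or_eq with hlt | hm
  · refine ⟨2, by omega, by omega, ?_, ?_⟩
    · intro i hi
      interval_cases i
      · exact s0
      · exact s1
    · rw [specMoment_two, specMoment_two, hP.1, hG2]
      have : (n : ℝ) < #G.edgeFinset := by exact_mod_cast hlt
      linarith
  have hs : 4 * n + 2 < ∑ v, G.degree v ^ 2 := by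
    by_contra h
    exact hne (iso_of_small hk G hconn hbr hm.symm (by omega))
  have h5 := five_le hk G hm.symm hs
  have s2 : specMoment (PnK n k) 2 = specMoment G 2 := by
    rw [specMoment_two, specMoment_two, hP.1, hG2, ← hm]
  rcases compare_counts hk G hconn hbr hm.symm with h | ⟨h, h'⟩
  · refine ⟨3, by omega, by omega, ?_, ?_⟩
    · intro i hi
      interval_cases i
      · exact s0
      · exact s1
      · exact s2
    · rw [specMoment_three, specMoment_three]
      exact_mod_cast h
  · refine ⟨4, by omega, by omega, ?_, ?_⟩
    · intro i hi
      interval_cases i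
      · exact s0
      · exact s1
      · exact s2
      · rw [specMoment_three, specMoment_three, h]
    · rw [specMoment_four, specMoment_four, hP.1, hG2, ← hm]
      have h1 : (quadC (PnK n k) : ℝ) ≤ quadC G := by exact_mod_cast h'
      have h2 : (4 * n + 2 : ℝ) < ∑ v, (G.degree v : ℝ) ^ 2 := by exact_mod_cast hs
      have h3 := hP.2
      linarith

end helpers


/-- Of all connected graphs with `n` vertices and `k` cut edges (`0 ≤ k ≤ n - 3`),
the first graph in the `S`-order is obtained uniquely at `P_n^k`. -/
theorem first_in_S_order (n k : ℕ) (hn : 3 ≤ n) (hk : k ≤ n - 3)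
    (G : SimpleGraph (Fin n)) (hconn : G.Connected) (hbr : numBridges G = k)
    (hne : ¬ Nonempty (G ≃g PnK n k)) :
    SLt n (PnK n k) G := by
  exact main_aux (by omega) G hconn hbr hne
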